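/- Let m,n be nonnegative integers, a a positive integer, and p a prime with p > a(m+n)+2. Writing H(-)=H(-;p-1) and S(-)=S(-;p-1), one has H(\{a\}^m,-a,\{a\}^n) \equiv (-1)^{m+n} S(\{a\}^n,-a,\{a\}^m) \pmod{p} and H(\{a\}^m,-a,\{a\}^n) \equiv (-1)^{(m+n+1)(a+1)} S(\{a\}^m,-a,\{a\}^n) \pmod{p}. -/

import Mathlib

open Finset

/-- sign of an integer as a rational: `-1` if negative, else `1`. -/
def sgn (s : ℤ) : ℚ := if s < 0 then -1 else 1

/-- Auxiliary: alternating multiple harmonic sum with the index list reversed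
    (head of the list corresponds to the outermost, i.e. largest, summation index). -/
def Hrev : List ℤ → ℕ → ℚ
  | [], _ => 1
  | s :: t, n => ∑ k ∈ Finset.Icc 1 n, (sgn s) ^ k / (k : ℚ) ^ s.natAbs * Hrev t (k - 1)

/-- The alternating multiple harmonic sum `H(s₁,…,s_d; n)`:
    the sum over `1 ≤ k₁ < ⋯ < k_d ≤ n` of `∏ sign(sᵢ)^{kᵢ}/kᵢ^{|sᵢ|}`. -/
def H (s : List ℤ) (n : ℕ) : ℚ := Hrev s.reverse n

/-- Auxiliary for the non-strict version. -/
def Srev : List ℤ → ℕ → ℚ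
  | [], _ => 1
  | s :: t, n => ∑ k ∈ Finset.Icc 1 n, (sgn s) ^ k / (k : ℚ) ^ s.natAbs * Srev t k

/-- The non-strict alternating multiple harmonic sum `S(s₁,…,s_d; n)`:
    the sum over `1 ≤ k₁ ≤ ⋯ ≤ k_d ≤ n`. -/
def S (s : List ℤ) (n : ℕ) : ℚ := Srev s.reverse n

/-- `x ≡ y (mod m)` for rationals: the numerator of `x - y` in lowest terms is
    divisible by `m`. -/
def pcong (m : ℕ) (x y : ℚ) : Prop := (m : ℤ) ∣ (x - y).num

/-- The Fermat quotient of 2 : `q_p = (2^{p-1}-1)/p`. -/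
def qp (p : ℕ) : ℚ := (2 ^ (p - 1) - 1) / p

/-- `s ⊕ t = sign(st)(|s|+|t|)`, with the convention that `0 ⊕ t = t` and `s ⊕ 0 = s`. -/
def oplus (s t : ℤ) : ℤ :=
  if s = 0 then t else if t = 0 then s else (s * t).sign * (|s| + |t|)

namespace PalindromicBlock

/-! ### Nested sums with arbitrary weights -/

section NestedSums

variable {K : Type*} [Field K]

/-- Strict nested sum with weight functions in a field; the head of the list belongs to the
largest summation index. -/
def strictSum : List (ℕ → K) → ℕ → K
  | [], _ => 1
  | f :: t, n => ∑ k ∈ Finset.Icc 1 n, f k * strictSum t (k - 1)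

/-- Non-strict nested sum with weight functions in a field; the head of the list belongs to the
largest summation index. -/
def weakSum : List (ℕ → K) → ℕ → K
  | [], _ => 1
  | f :: t, n => ∑ k ∈ Finset.Icc 1 n, f k * weakSum t k

/-- The generating series `∏_{j ∈ s} (1 + x_j X)` of elementary symmetric functions. -/
noncomputable def elemSeries (x : ℕ → K) (s : Finset ℕ) : PowerSeries K :=
  ∏ j ∈ s, (1 + PowerSeries.C (x j) * PowerSeries.X)

/-- The generating series `∏_{j ∈ s} (1 + x_j X)⁻¹` of signed complete symmetric functions. -/
noncomputable def complSeries (x : ℕ → K) (s : Finset ℕ) : PowerSeries K :=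
  ∏ j ∈ s, (1 + PowerSeries.C (x j) * PowerSeries.X)⁻¹

theorem linear_mul_inv (c : K) :
    (1 + PowerSeries.C c * PowerSeries.X) * (1 + PowerSeries.C c * PowerSeries.X)⁻¹ = 1 :=
  PowerSeries.mul_inv_cancel _ (by simp)

theorem elemSeries_mul_complSeries (x : ℕ → K) (s : Finset ℕ) :
    elemSeries x s * complSeries x s = 1 := by
  rw [elemSeries, complSeries, ← Finset.prod_mul_distrib]
  exact Finset.prod_eq_one fun j _ => linear_mul_inv (x j)

theorem constantCoeff_elemSeries (x : ℕ → K) (s : Finset ℕ) :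
    PowerSeries.coeff 0 (elemSeries x s) = 1 := by
  simp [elemSeries, map_prod]

theorem constantCoeff_complSeries (x : ℕ → K) (s : Finset ℕ) :
    PowerSeries.coeff 0 (complSeries x s) = 1 := by
  have h := congrArg (PowerSeries.coeff 0) (elemSeries_mul_complSeries x s)
  simpa [PowerSeries.coeff_mul, constantCoeff_elemSeries] using h

theorem coeff_linear_mul (c : K) (f : PowerSeries K) (n : ℕ) :
    PowerSeries.coeff (n + 1) ((1 + PowerSeries.C c * PowerSeries.X) * f) =
      PowerSeries.coeff (n + 1) f + c * PowerSeries.coeff n f := by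
  rw [add_mul, one_mul, mul_assoc, map_add, PowerSeries.coeff_C_mul,
    PowerSeries.coeff_succ_X_mul]

theorem coeff_elemSeries_Icc_succ (x : ℕ → K) {l N : ℕ} (h : l ≤ N + 1) (n : ℕ) :
    PowerSeries.coeff (n + 1) (elemSeries x (Finset.Icc l (N + 1))) =
      PowerSeries.coeff (n + 1) (elemSeries x (Finset.Icc l N)) +
        x (N + 1) * PowerSeries.coeff n (elemSeries x (Finset.Icc l N)) := by
  rw [← coeff_linear_mul]
  congr 1
  rw [elemSeries, Finset.prod_Icc_succ_top h, mul_comm, elemSeries]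

theorem coeff_complSeries_Icc_succ (x : ℕ → K) {l N : ℕ} (h : l ≤ N + 1) (n : ℕ) :
    PowerSeries.coeff (n + 1) (complSeries x (Finset.Icc l (N + 1))) =
      PowerSeries.coeff (n + 1) (complSeries x (Finset.Icc l N)) -
        x (N + 1) * PowerSeries.coeff n (complSeries x (Finset.Icc l (N + 1))) := by
  rw [eq_sub_iff_add_eq, ← coeff_linear_mul]
  congr 1
  rw [complSeries, Finset.prod_Icc_succ_top h, mul_left_comm, linear_mul_inv, mul_one, complSeries]

theorem strictSum_cons_succ (f : ℕ → K) (t : List (ℕ → K)) (N : ℕ) :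
    strictSum (f :: t) (N + 1) = strictSum (f :: t) N + f (N + 1) * strictSum t N := by
  simp [strictSum, Finset.sum_Icc_succ_top]

theorem weakSum_cons_succ (f : ℕ → K) (t : List (ℕ → K)) (N : ℕ) :
    weakSum (f :: t) (N + 1) = weakSum (f :: t) N + f (N + 1) * weakSum t (N + 1) := by
  simp [weakSum, Finset.sum_Icc_succ_top]

theorem strictSum_replicate (x : ℕ → K) (n N : ℕ) :
    strictSum (List.replicate n x) N =
      PowerSeries.coeff n (elemSeries x (Finset.Icc 1 N)) := by
  induction n generalizing N with
  | zero => simp [strictSum, constantCoeff_elemSeries, -PowerSeries.coeff_zero_eq_constantCoeff]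
  | succ n ih =>
    induction N with
    | zero => simp [strictSum, List.replicate_succ, elemSeries, PowerSeries.coeff_one]
    | succ N ihN =>
      rw [coeff_elemSeries_Icc_succ x (by omega), ← ihN, ← ih, List.replicate_succ,
        strictSum_cons_succ]

theorem weakSum_replicate (x : ℕ → K) (n N : ℕ) :
    (-1) ^ n * weakSum (List.replicate n x) N =
      PowerSeries.coeff n (complSeries x (Finset.Icc 1 N)) := by
  induction n generalizing N with
  | zero => simp [weakSum, constantCoeff_complSeries, -PowerSeries.coeff_zero_eq_constantCoeff]
  | succ n ih =>
    induction N with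
    | zero => simp [weakSum, List.replicate_succ, complSeries, PowerSeries.coeff_one]
    | succ N ihN =>
      rw [coeff_complSeries_Icc_succ x (by omega), ← ihN, ← ih, List.replicate_succ,
        weakSum_cons_succ]
      ring

theorem strictSum_block (x c : ℕ → K) (m n N : ℕ) :
    strictSum (List.replicate n x ++ c :: List.replicate m x) N =
      ∑ k ∈ Finset.Icc 1 N, c k *
        (PowerSeries.coeff m (elemSeries x (Finset.Icc 1 (k - 1))) *
          PowerSeries.coeff n (elemSeries x (Finset.Icc (k + 1) N))) := by
  induction n generalizing N with
  | zero =>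
    simp [strictSum, strictSum_replicate, constantCoeff_elemSeries,
      -PowerSeries.coeff_zero_eq_constantCoeff]
  | succ n ih =>
    induction N with
    | zero => simp [strictSum, List.replicate_succ]
    | succ N ihN =>
      rw [List.replicate_succ, List.cons_append] at ihN ⊢
      rw [strictSum_cons_succ, ihN, ih, Finset.sum_Icc_succ_top (by omega)]
      simp only [Finset.Icc_eq_empty_of_lt (Nat.lt_succ_self (N + 1)), elemSeries,
        Finset.prod_empty, PowerSeries.coeff_one]
      simp only [Nat.add_one_ne_zero, if_false, mul_zero, add_zero]
      rw [Finset.mul_sum, ← Finset.sum_add_distrib]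
      refine Finset.sum_congr rfl fun k hk => ?_
      have h := coeff_elemSeries_Icc_succ x (l := k + 1) (N := N)
        (by simp only [Finset.mem_Icc] at hk; omega) n
      simp only [elemSeries] at h
      rw [h]
      ring

theorem weakSum_block (x c : ℕ → K) (m n N : ℕ) :
    (-1) ^ (m + n) * weakSum (List.replicate m x ++ c :: List.replicate n x) N =
      ∑ k ∈ Finset.Icc 1 N, c k *
        (PowerSeries.coeff m (complSeries x (Finset.Icc k N)) *
          PowerSeries.coeff n (complSeries x (Finset.Icc 1 k))) := by
  induction m generalizing N with
  | zero =>
    simp only [List.replicate_zero, List.nil_append, weakSum, Finset.mul_sum, zero_add,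
      constantCoeff_complSeries, one_mul, ← weakSum_replicate]
    exact Finset.sum_congr rfl fun k _ => by ring
  | succ m ih =>
    induction N with
    | zero => simp [weakSum, List.replicate_succ]
    | succ N ihN =>
      have hrec : (-1) ^ (m + 1 + n) *
            weakSum (List.replicate (m + 1) x ++ c :: List.replicate n x) (N + 1) =
          (-1) ^ (m + 1 + n) * weakSum (List.replicate (m + 1) x ++ c :: List.replicate n x) N -
            x (N + 1) * ((-1) ^ (m + n) *
              weakSum (List.replicate m x ++ c :: List.replicate n x) (N + 1)) := by
        rw [List.replicate_succ, List.cons_append, weakSum_cons_succ]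
        ring
      have hlast : ∑ k ∈ Finset.Icc 1 N, c k *
            (PowerSeries.coeff (m + 1) (complSeries x (Finset.Icc k N)) *
              PowerSeries.coeff n (complSeries x (Finset.Icc 1 k))) =
          ∑ k ∈ Finset.Icc 1 (N + 1), c k *
            (PowerSeries.coeff (m + 1) (complSeries x (Finset.Icc k N)) *
              PowerSeries.coeff n (complSeries x (Finset.Icc 1 k))) := by
        rw [Finset.sum_Icc_succ_top (by omega)]
        simp [complSeries, PowerSeries.coeff_one]
      rw [hrec, ihN, ih, hlast, Finset.mul_sum, ← Finset.sum_sub_distrib]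
      refine Finset.sum_congr rfl fun k hk => ?_
      rw [coeff_complSeries_Icc_succ x (Finset.mem_Icc.mp hk).2 m]
      ring

theorem coeff_mul_of_coeff_eq_zero {T : PowerSeries K} {m : ℕ} (h0 : PowerSeries.coeff 0 T = 1)
    (h : ∀ i, 0 < i → i ≤ m → PowerSeries.coeff i T = 0) (Q : PowerSeries K) :
    PowerSeries.coeff m (T * Q) = PowerSeries.coeff m Q := by
  rw [PowerSeries.coeff_mul, Finset.sum_eq_single (0, m)]
  · rw [h0, one_mul]
  · rintro ⟨i, j⟩ hij hne
    rw [Finset.HasAntidiagonal.mem_antidiagonal] at hij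
    rw [h i _ (by omega), zero_mul]
    rcases Nat.eq_zero_or_pos i with rfl | hi
    · exact absurd (by simpa using hij) (by simpa using hne)
    · exact hi
  · simp

theorem elemSeries_eq_mul_complSeries (x : ℕ → K) {s t u : Finset ℕ} (hd : Disjoint s t)
    (hu : s ∪ t = u) : elemSeries x s = elemSeries x u * complSeries x t := by
  have h : elemSeries x u = elemSeries x s * elemSeries x t := by
    rw [← hu, elemSeries, Finset.prod_union hd, elemSeries, elemSeries]
  rw [h, mul_assoc, elemSeries_mul_complSeries, mul_one]

/-- If the first elementary symmetric functions of `x 1, …, x N` vanish, then strict and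
non-strict block sums agree up to sign. -/
theorem strictSum_block_eq_weakSum_block (x c : ℕ → K) (m n N : ℕ)
    (hm : ∀ i, 0 < i → i ≤ m → PowerSeries.coeff i (elemSeries x (Finset.Icc 1 N)) = 0)
    (hn : ∀ i, 0 < i → i ≤ n → PowerSeries.coeff i (elemSeries x (Finset.Icc 1 N)) = 0) :
    strictSum (List.replicate n x ++ c :: List.replicate m x) N =
      (-1) ^ (m + n) * weakSum (List.replicate m x ++ c :: List.replicate n x) N := by
  rw [strictSum_block, weakSum_block]
  refine Finset.sum_congr rfl fun k hk => ?_
  rw [Finset.mem_Icc] at hk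
  rw [elemSeries_eq_mul_complSeries x (s := Finset.Icc 1 (k - 1)) (t := Finset.Icc k N)
      (u := Finset.Icc 1 N)
      (Finset.disjoint_left.mpr fun j => by simp only [Finset.mem_Icc]; omega)
      (by ext j; simp only [Finset.mem_union, Finset.mem_Icc]; omega),
    elemSeries_eq_mul_complSeries x (s := Finset.Icc (k + 1) N) (t := Finset.Icc 1 k)
      (u := Finset.Icc 1 N)
      (Finset.disjoint_left.mpr fun j => by simp only [Finset.mem_Icc]; omega)
      (by ext j; simp only [Finset.mem_union, Finset.mem_Icc]; omega),
    coeff_mul_of_coeff_eq_zero (constantCoeff_elemSeries x _) hm,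
    coeff_mul_of_coeff_eq_zero (constantCoeff_elemSeries x _) hn]

theorem coeff_elemSeries_reflect (x : ℕ → K) (ε : K) {p k : ℕ} (hk : k ≤ p)
    (hx : ∀ j ∈ Finset.Icc 1 (p - 1), x (p - j) = ε * x j) (n : ℕ) :
    PowerSeries.coeff n (elemSeries x (Finset.Icc (p - k + 1) (p - 1))) =
      ε ^ n * PowerSeries.coeff n (elemSeries x (Finset.Icc 1 (k - 1))) := by
  rw [← PowerSeries.coeff_rescale]
  congr 1
  rw [elemSeries, elemSeries, map_prod]
  refine Finset.prod_nbij' (fun j => p - j) (fun j => p - j) ?_ ?_ ?_ ?_ ?_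
  · intro j; simp only [Finset.mem_Icc]; omega
  · intro j; simp only [Finset.mem_Icc]; omega
  · intro j; simp only [Finset.mem_Icc]; omega
  · intro j; simp only [Finset.mem_Icc]; omega
  · intro j hj
    have hj' : p - j ∈ Finset.Icc 1 (p - 1) := by
      simp only [Finset.mem_Icc] at hj ⊢; omega
    have h := hx _ hj'
    rw [Nat.sub_sub_self (by simp only [Finset.mem_Icc] at hj; omega)] at h
    have hC : PowerSeries.rescale ε (PowerSeries.C (x (p - j))) = PowerSeries.C (x (p - j)) := by
      ext i
      rw [PowerSeries.coeff_rescale, PowerSeries.coeff_C]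
      split_ifs with hi <;> simp [hi]
    rw [h, map_add, map_one, map_mul PowerSeries.C, map_mul (PowerSeries.rescale ε), hC,
      PowerSeries.rescale_X]
    ring

/-- Reversal of a strict block sum under `k ↦ p - k`. -/
theorem strictSum_block_reflect (x c : ℕ → K) (ε δ : K) (m n p : ℕ)
    (hx : ∀ j ∈ Finset.Icc 1 (p - 1), x (p - j) = ε * x j)
    (hc : ∀ j ∈ Finset.Icc 1 (p - 1), c (p - j) = δ * c j)
    (hε : ε * ε = 1) :
    strictSum (List.replicate n x ++ c :: List.replicate m x) (p - 1) =
      δ * ε ^ (m + n) * strictSum (List.replicate m x ++ c :: List.replicate n x) (p - 1) := by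
  rw [strictSum_block, strictSum_block, Finset.mul_sum]
  refine Finset.sum_nbij' (fun j => p - j) (fun j => p - j) ?_ ?_ ?_ ?_ ?_
  · intro j; simp only [Finset.mem_Icc]; omega
  · intro j; simp only [Finset.mem_Icc]; omega
  · intro j; simp only [Finset.mem_Icc]; omega
  · intro j; simp only [Finset.mem_Icc]; omega
  · intro j hj
    have hj0 := Finset.mem_Icc.mp hj
    have hj' : p - j ∈ Finset.Icc 1 (p - 1) := by rw [Finset.mem_Icc]; omega
    have h := hc _ hj'
    rw [Nat.sub_sub_self (by omega)] at h
    have h1 := coeff_elemSeries_reflect x ε (k := j) (by omega) hx m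
    have h2 := coeff_elemSeries_reflect x ε (k := p - j) (by omega) hx n
    rw [Nat.sub_sub_self (by omega)] at h2
    have hm : ε ^ m * ε ^ m = 1 := by rw [← mul_pow, hε, one_pow]
    rw [h, h1, h2, pow_add]
    linear_combination (-δ * c (p - j) * ε ^ n *
      PowerSeries.coeff m (elemSeries x (Finset.Icc 1 (j - 1))) *
      PowerSeries.coeff n (elemSeries x (Finset.Icc 1 (p - j - 1)))) * hm

end NestedSums

/-! ### Reduction modulo `p` -/

section Reduction

variable {p : ℕ} [Fact p.Prime]

/-- `q` is `p`-integral with residue `z`. -/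
def HasResidue (q : ℚ) (z : ZMod p) : Prop := (q.den : ZMod p) ≠ 0 ∧ (q : ZMod p) = z

theorem cast_ne_zero_of_dvd {a b : ℕ} (h : a ∣ b) (hb : (b : ZMod p) ≠ 0) :
    (a : ZMod p) ≠ 0 := by
  obtain ⟨c, rfl⟩ := h
  rw [Nat.cast_mul] at hb
  exact left_ne_zero_of_mul hb

theorem HasResidue.add {q r : ℚ} {y z : ZMod p} (hq : HasResidue q y) (hr : HasResidue r z) :
    HasResidue (q + r) (y + z) :=
  ⟨cast_ne_zero_of_dvd (Rat.add_den_dvd q r) (by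
    rw [Nat.cast_mul]; exact mul_ne_zero hq.1 hr.1),
    by rw [Rat.cast_add_of_ne_zero hq.1 hr.1, hq.2, hr.2]⟩

theorem HasResidue.mul {q r : ℚ} {y z : ZMod p} (hq : HasResidue q y) (hr : HasResidue r z) :
    HasResidue (q * r) (y * z) :=
  ⟨cast_ne_zero_of_dvd (Rat.mul_den_dvd q r) (by
    rw [Nat.cast_mul]; exact mul_ne_zero hq.1 hr.1),
    by rw [Rat.cast_mul_of_ne_zero hq.1 hr.1, hq.2, hr.2]⟩

theorem HasResidue.intCast (k : ℤ) : HasResidue (k : ℚ) (k : ZMod p) := by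
  simp [HasResidue]

theorem HasResidue.one : HasResidue (1 : ℚ) (1 : ZMod p) := by
  simpa using HasResidue.intCast (p := p) 1

theorem HasResidue.neg_one : HasResidue (-1 : ℚ) (-1 : ZMod p) := by
  simpa using HasResidue.intCast (p := p) (-1)

theorem HasResidue.pow {q : ℚ} {z : ZMod p} (h : HasResidue q z) (n : ℕ) :
    HasResidue (q ^ n) (z ^ n) := by
  induction n with
  | zero => simpa using HasResidue.one
  | succ n ih => rw [pow_succ, pow_succ]; exact ih.mul h

theorem HasResidue.sum {ι : Type*} {s : Finset ι} {f : ι → ℚ} {g : ι → ZMod p}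
    (h : ∀ i ∈ s, HasResidue (f i) (g i)) : HasResidue (∑ i ∈ s, f i) (∑ i ∈ s, g i) := by
  classical
  induction s using Finset.induction_on with
  | empty => simpa using HasResidue.intCast (p := p) 0
  | insert i s hi ih =>
    rw [Finset.sum_insert hi, Finset.sum_insert hi]
    exact (h i (Finset.mem_insert_self i s)).add
      (ih fun j hj => h j (Finset.mem_insert_of_mem hj))

theorem natCast_ne_zero_of_mem_Icc {k : ℕ} (hk : k ∈ Finset.Icc 1 (p - 1)) :
    (k : ZMod p) ≠ 0 := by
  rw [Finset.mem_Icc] at hk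
  rw [Ne, ZMod.natCast_eq_zero_iff]
  intro h
  have := Nat.le_of_dvd hk.1 h
  omega

theorem HasResidue.inv_natCast {k : ℕ} (hk : k ∈ Finset.Icc 1 (p - 1)) :
    HasResidue (k : ℚ)⁻¹ (k : ZMod p)⁻¹ := by
  have h0 := natCast_ne_zero_of_mem_Icc hk
  have hk0 : k ≠ 0 := by rw [Finset.mem_Icc] at hk; omega
  refine ⟨?_, by simp⟩
  rw [Rat.inv_natCast_den_of_pos (Nat.pos_of_ne_zero hk0)]
  exact h0

theorem pcong_of_hasResidue {q r : ℚ} {z : ZMod p} (hq : HasResidue q z) (hr : HasResidue r z) :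
    pcong p q r := by
  have h := hq.add (HasResidue.neg_one.mul hr)
  rw [show q + -1 * r = q - r by ring, show z + -1 * z = 0 by ring] at h
  obtain ⟨hd, h0⟩ := h
  rw [Rat.cast_def, div_eq_zero_iff, or_iff_left hd] at h0
  exact (ZMod.intCast_zmod_eq_zero_iff_dvd _ _).mp h0

/-- The residue of the summand `sign(s)^k / k^|s|`. -/
def residueWeight (p : ℕ) [Fact p.Prime] (s : ℤ) (k : ℕ) : ZMod p :=
  (if s < 0 then -1 else 1) ^ k * ((k : ZMod p)⁻¹) ^ s.natAbs

theorem hasResidue_weight (s : ℤ) {k : ℕ} (hk : k ∈ Finset.Icc 1 (p - 1)) :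
    HasResidue (sgn s ^ k / (k : ℚ) ^ s.natAbs) (residueWeight p s k) := by
  rw [div_eq_mul_inv, ← inv_pow]
  refine HasResidue.mul (HasResidue.pow ?_ k) ((HasResidue.inv_natCast hk).pow _)
  unfold sgn
  split_ifs
  · exact HasResidue.neg_one
  · exact HasResidue.one

theorem hasResidue_Hrev (s : List ℤ) {N : ℕ} (hN : N ≤ p - 1) :
    HasResidue (Hrev s N) (strictSum (s.map (residueWeight p)) N) := by
  induction s generalizing N with
  | nil => exact HasResidue.one
  | cons a t ih =>
    refine HasResidue.sum fun k hk => (hasResidue_weight a ?_).mul (ih ?_)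
    · rw [Finset.mem_Icc] at hk ⊢; omega
    · rw [Finset.mem_Icc] at hk; omega

theorem hasResidue_Srev (s : List ℤ) {N : ℕ} (hN : N ≤ p - 1) :
    HasResidue (Srev s N) (weakSum (s.map (residueWeight p)) N) := by
  induction s generalizing N with
  | nil => exact HasResidue.one
  | cons a t ih =>
    refine HasResidue.sum fun k hk => (hasResidue_weight a ?_).mul (ih ?_)
    · rw [Finset.mem_Icc] at hk ⊢; omega
    · rw [Finset.mem_Icc] at hk; omega

theorem elemSeries_residueWeight_eq_prod_units (a : ℕ) :
    elemSeries (residueWeight p a) (Finset.Icc 1 (p - 1)) =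
      ∏ u : (ZMod p)ˣ, (1 + PowerSeries.C ((u : ZMod p) ^ a) * PowerSeries.X) := by
  have hp : p.Prime := Fact.out
  have hp1 := hp.one_lt
  symm
  refine Finset.prod_bij (fun u _ => ((u⁻¹ : (ZMod p)ˣ) : ZMod p).val) ?_ ?_ ?_ ?_
  · intro u _
    have h1 := ZMod.val_lt ((u⁻¹ : (ZMod p)ˣ) : ZMod p)
    have h2 : ((u⁻¹ : (ZMod p)ˣ) : ZMod p).val ≠ 0 := by
      rw [Ne, ZMod.val_eq_zero]; exact Units.ne_zero _
    rw [Finset.mem_Icc]; omega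
  · intro u _ v _ h
    exact inv_injective (Units.ext (ZMod.val_injective p h))
  · intro k hk
    refine ⟨(Units.mk0 (k : ZMod p) (natCast_ne_zero_of_mem_Icc hk))⁻¹, Finset.mem_univ _, ?_⟩
    rw [inv_inv, Units.val_mk0]
    rw [Finset.mem_Icc] at hk
    exact ZMod.val_cast_of_lt (by omega)
  · intro u _
    rw [residueWeight, ZMod.natCast_zmod_val, if_neg (by omega), Int.natAbs_natCast,
      Units.val_inv_eq_inv_val, inv_inv, one_pow, one_mul]

/-- The elementary symmetric functions of `1/1^a, …, 1/(p-1)^a` vanish modulo `p`. -/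
theorem coeff_elemSeries_residueWeight (a i : ℕ) (h0 : 0 < a * i) (hlt : a * i < p - 1) :
    PowerSeries.coeff i (elemSeries (residueWeight p a) (Finset.Icc 1 (p - 1))) = 0 := by
  obtain ⟨g, hg⟩ := IsCyclic.exists_generator (α := (ZMod p)ˣ)
  have hord : orderOf g = p - 1 := by
    rw [orderOf_eq_card_of_forall_mem_zpowers hg, Nat.card_eq_fintype_card, ZMod.card_units]
  have hgi : ((g : ZMod p) ^ a) ^ i ≠ 1 := by
    intro h
    rw [← pow_mul, ← Units.val_pow_eq_pow_val, Units.val_eq_one] at h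
    have := Nat.le_of_dvd h0 (orderOf_dvd_of_pow_eq_one h)
    omega
  have hinv : PowerSeries.rescale ((g : ZMod p) ^ a)
      (∏ u : (ZMod p)ˣ, (1 + PowerSeries.C ((u : ZMod p) ^ a) * PowerSeries.X)) =
      ∏ u : (ZMod p)ˣ, (1 + PowerSeries.C ((u : ZMod p) ^ a) * PowerSeries.X) := by
    rw [map_prod]
    refine Fintype.prod_equiv (Equiv.mulLeft g) _ _ fun u => ?_
    have hC : PowerSeries.rescale ((g : ZMod p) ^ a) (PowerSeries.C ((u : ZMod p) ^ a)) =
        PowerSeries.C ((u : ZMod p) ^ a) := by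
      ext i
      rw [PowerSeries.coeff_rescale, PowerSeries.coeff_C]
      split_ifs with hi <;> simp [hi]
    rw [map_add, map_one, map_mul, hC, PowerSeries.rescale_X, Equiv.coe_mulLeft, Units.val_mul,
      mul_pow, map_mul]
    ring
  rw [elemSeries_residueWeight_eq_prod_units]
  have h := congrArg (PowerSeries.coeff i) hinv
  rw [PowerSeries.coeff_rescale] at h
  by_contra hne
  exact hgi (mul_right_cancel₀ hne (h.trans (one_mul _).symm))

theorem residueWeight_reflect (a : ℕ) {j : ℕ} (hj : j ∈ Finset.Icc 1 (p - 1)) :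
    residueWeight p a (p - j) = (-1) ^ a * residueWeight p a j := by
  rw [Finset.mem_Icc] at hj
  simp only [residueWeight, Nat.cast_sub (show j ≤ p by omega), CharP.cast_eq_zero, zero_sub,
    inv_neg, Int.natAbs_natCast]
  rw [if_neg (by omega), neg_pow]
  simp

theorem residueWeight_neg_reflect (a : ℕ) (ha : 0 < a) (hp2 : 2 < p) {j : ℕ}
    (hj : j ∈ Finset.Icc 1 (p - 1)) :
    residueWeight p (-a) (p - j) = (-1) ^ (a + 1) * residueWeight p (-a) j := by
  have hp : p.Prime := Fact.out
  rw [Finset.mem_Icc] at hj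
  have hsign : (-1 : ZMod p) ^ (p - j) = -(-1) ^ j := by
    have h1 : (-1 : ZMod p) ^ (p - j) * (-1) ^ j = -1 := by
      rw [← pow_add, Nat.sub_add_cancel (by omega), (hp.odd_of_ne_two (by omega)).neg_one_pow]
    have h2 : (-1 : ZMod p) ^ j * (-1) ^ j = 1 := by rw [← mul_pow]; simp
    linear_combination (-1) ^ j * h1 - (-1) ^ (p - j) * h2
  simp only [residueWeight, Nat.cast_sub (show j ≤ p by omega), CharP.cast_eq_zero, zero_sub,
    inv_neg, Int.natAbs_neg, Int.natAbs_natCast]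
  rw [if_pos (by omega), hsign, neg_pow ((j : ZMod p)⁻¹)]
  ring

end Reduction

end PalindromicBlock

open PalindromicBlock

/-- `H({a}^m, -a, {a}^n)` versus the non-strict sums `S`, modulo `p`. -/
theorem H_S_palindromic_block (m n a : ℕ) (ha : 0 < a) (p : ℕ) (hp : p.Prime)
    (hpw : a * (m + n) + 2 < p) :
    pcong p (H (List.replicate m (a : ℤ) ++ [-(a : ℤ)] ++ List.replicate n (a : ℤ)) (p - 1))
      ((-1 : ℚ) ^ (m + n) *
        S (List.replicate n (a : ℤ) ++ [-(a : ℤ)] ++ List.replicate m (a : ℤ)) (p - 1)) ∧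
    pcong p (H (List.replicate m (a : ℤ) ++ [-(a : ℤ)] ++ List.replicate n (a : ℤ)) (p - 1))
      ((-1 : ℚ) ^ ((m + n + 1) * (a + 1)) *
        S (List.replicate m (a : ℤ) ++ [-(a : ℤ)] ++ List.replicate n (a : ℤ)) (p - 1)) := by
  have : Fact p.Prime := ⟨hp⟩
  have hH (m n : ℕ) : HasResidue
      (H (List.replicate m (a : ℤ) ++ [-(a : ℤ)] ++ List.replicate n (a : ℤ)) (p - 1))
      (strictSum (List.replicate n (residueWeight p a) ++
        residueWeight p (-a) :: List.replicate m (residueWeight p a)) (p - 1)) := by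
    simpa [H] using hasResidue_Hrev (p := p)
      (List.replicate m (a : ℤ) ++ [-(a : ℤ)] ++ List.replicate n (a : ℤ)).reverse le_rfl
  have hS (m n : ℕ) : HasResidue
      (S (List.replicate m (a : ℤ) ++ [-(a : ℤ)] ++ List.replicate n (a : ℤ)) (p - 1))
      (weakSum (List.replicate n (residueWeight p a) ++
        residueWeight p (-a) :: List.replicate m (residueWeight p a)) (p - 1)) := by
    simpa [S] using hasResidue_Srev (p := p)
      (List.replicate m (a : ℤ) ++ [-(a : ℤ)] ++ List.replicate n (a : ℤ)).reverse le_rfl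
  have hvanish (i : ℕ) (h0 : 0 < i) (hi : i ≤ m + n) :
      PowerSeries.coeff i (elemSeries (residueWeight p a) (Finset.Icc 1 (p - 1))) = 0 := by
    have := Nat.mul_le_mul_left a hi
    exact coeff_elemSeries_residueWeight a i (Nat.mul_pos ha h0) (by omega)
  have hm (i : ℕ) (h0 : 0 < i) (hi : i ≤ m) := hvanish i h0 (by omega)
  have hn (i : ℕ) (h0 : 0 < i) (hi : i ≤ n) := hvanish i h0 (by omega)
  refine ⟨pcong_of_hasResidue (hH m n) ?_, pcong_of_hasResidue (hH m n) ?_⟩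
  · rw [strictSum_block_eq_weakSum_block _ _ m n _ hm hn]
    exact (HasResidue.neg_one.pow _).mul (hS n m)
  · rw [strictSum_block_reflect _ _ ((-1) ^ a) ((-1) ^ (a + 1)) m n p
      (fun j hj => residueWeight_reflect a hj)
      (fun j hj => residueWeight_neg_reflect a ha (by omega) hj)
      (by rw [← mul_pow]; simp),
      strictSum_block_eq_weakSum_block _ _ n m _ hn hm, ← mul_assoc]
    convert (HasResidue.neg_one.pow ((m + n + 1) * (a + 1))).mul (hS m n) using 2
    ring
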